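/- For every real s > 1, ∑_{n=1}^{∞} (μ ∗ Ω)(n) / n^s = ∑_p 1/(p^s - 1), where the right-hand sum is over all primes p. -/

import Mathlib

open Finset Filter Real ArithmeticFunction

/-- The Dirichlet convolution `(μ ∗ Ω)(n) = ∑_{d ∣ n} μ(d) Ω(n/d)`. -/
noncomputable def muConvOmega (n : ℕ) : ℤ :=
  ∑ d ∈ n.divisors, moebius d * (cardFactors (n / d) : ℤ)

/-- `Ω(n)` counts the divisors of `n` that are prime powers. -/
theorem card_filter_isPrimePow_divisors {n : ℕ} (hn : n ≠ 0) :
    #{d ∈ n.divisors | IsPrimePow d} = cardFactors n := by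
  induction n using Nat.recOnPrimeCoprime with
  | zero => exact absurd rfl hn
  | prime_pow p k hp =>
    rw [cardFactors_apply_prime_pow hp, card_filter, Nat.sum_divisors_prime_pow hp,
      sum_range_succ']
    simp [isPrimePow_pow_iff (Nat.succ_ne_zero _), hp.isPrimePow, not_isPrimePow_one]
  | coprime a b ha hb hab iha ihb =>
    rw [Nat.mul_divisors_filter_prime_pow hab, filter_union,
      card_union_of_disjoint (Nat.disjoint_divisors_filter_isPrimePow hab),
      iha (by lia), ihb (by lia), cardFactors_mul (by lia) (by lia)]

/-- `μ ∗ Ω` is the indicator function of the prime powers. -/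
theorem muConvOmega_eq_ite (n : ℕ) : muConvOmega n = if IsPrimePow n then 1 else 0 := by
  rcases n.eq_zero_or_pos with rfl | hn
  · simp [muConvOmega, not_isPrimePow_zero]
  · have h := (sum_eq_iff_sum_mul_moebius_eq (R := ℤ)
      (f := fun n ↦ if IsPrimePow n then 1 else 0) (g := fun n ↦ (cardFactors n : ℤ))).1
      (fun m hm ↦ by
        rw [← card_filter_isPrimePow_divisors hm.ne', sum_boole]) n hn
    rw [← h, Nat.sum_divisorsAntidiagonal (fun a b ↦ (Int.cast (moebius a) : ℤ) * (cardFactors b : ℤ))]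
    rfl

/-- The geometric series without its constant term, at ratio `x⁻¹`. -/
theorem tsum_one_div_pow_succ {x : ℝ} (hx : 1 < x) :
    ∑' k : ℕ, 1 / x ^ (k + 1) = 1 / (x - 1) := by
  have hx0 : x ≠ 0 := by positivity
  have hx1 : x - 1 ≠ 0 := by linarith
  simp_rw [one_div, ← inv_pow, pow_succ]
  rw [tsum_mul_right, tsum_geometric_of_lt_one (by positivity) (inv_lt_one_of_one_lt₀ hx)]
  field_simp

theorem dirichlet_series_muConvOmega (s : ℝ) (hs : 1 < s) :
    ∑' n : ℕ+, (muConvOmega n : ℝ) / (n : ℝ) ^ s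
      = ∑' p : {p : ℕ // p.Prime}, 1 / ((p : ℝ) ^ s - 1) := by
  have hsum : Summable fun n : ℕ ↦ (muConvOmega n : ℝ) / (n : ℝ) ^ s := by
    refine (Real.summable_one_div_nat_rpow.2 hs).of_nonneg_of_le (fun n ↦ ?_) fun n ↦ ?_ <;>
    · rw [muConvOmega_eq_ite]
      split_ifs <;> (simp; try positivity)
  have hsupp : (Function.support fun n : ℕ ↦ (muConvOmega n : ℝ) / (n : ℝ) ^ s) ⊆
      {n | IsPrimePow n} := by
    intro n hn
    by_contra h
    simp_all [muConvOmega_eq_ite]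
  rw [tsum_pnat_eq_tsum_of_eq_zero (f := fun n : ℕ ↦ (muConvOmega n : ℝ) / (n : ℝ) ^ s)
      (by simp [muConvOmega]),
    tsum_eq_tsum_primes_of_support_subset_prime_powers hsum hsupp]
  refine tsum_congr fun p ↦ ?_
  rw [← tsum_one_div_pow_succ (Real.one_lt_rpow (mod_cast p.2.one_lt) (by linarith))]
  refine tsum_congr fun k ↦ ?_
  rw [muConvOmega_eq_ite, if_pos (p.2.isPrimePow.pow k.succ_ne_zero), Nat.cast_pow,
    ← Real.rpow_pow_comm p.1.cast_nonneg, Int.cast_one]
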